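/- Let m ≥ 2 and r be integers with 1 ≤ r < m/2, let τ be a complex number with positive imaginary part, and set q = e^{2πiτ}. Then Θ(rτ; mτ) ≠ 0 and Π_{j≥0} [ (1 − q^{mj+r})(1 − q^{mj+m−r}) ]^{−1} = −i · e^{2πiτ(m/12 − r/2)} · η(mτ) / Θ(rτ; mτ). -/

import Mathlib

open Complex

/-- The Dedekind eta function
`η(τ) = e^{πiτ/12} Π_{n≥1} (1 - e^{2πinτ})` on the upper half plane. -/
noncomputable def dedekindEta (τ : ℂ) : ℂ :=
  Complex.exp (Real.pi * I * τ / 12) *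
    ∏' n : ℕ, (1 - Complex.exp (2 * Real.pi * I * (n + 1) * τ))

/-- The Jacobi theta function
`Θ(w; τ) = Σ_{n ∈ 1/2 + ℤ} e^{πin²τ + 2πin(w + 1/2)}`. -/
noncomputable def jacobiThetaHalf (w τ : ℂ) : ℂ :=
  ∑' k : ℤ, Complex.exp (Real.pi * I * ((k : ℂ) + 1 / 2) ^ 2 * τ +
    2 * Real.pi * I * ((k : ℂ) + 1 / 2) * (w + 1 / 2))

section JacobiTripleProduct

open Filter Topology

/-- The Gaussian binomial coefficient, given by the `q`-Pascal recursion. -/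
def gaussBinom {R : Type*} [CommRing R] (q : R) : ℕ → ℕ → R
  | _, 0 => 1
  | 0, _ + 1 => 0
  | n + 1, k + 1 => gaussBinom q n k + q ^ (k + 1) * gaussBinom q n (k + 1)

section Algebra

variable {R : Type*} [CommRing R]

@[simp]
lemma gaussBinom_zero_right (q : R) (n : ℕ) : gaussBinom q n 0 = 1 := by
  cases n <;> rfl

lemma gaussBinom_succ_succ (q : R) (n k : ℕ) :
    gaussBinom q (n + 1) (k + 1) = gaussBinom q n k + q ^ (k + 1) * gaussBinom q n (k + 1) :=
  rfl

lemma gaussBinom_eq_zero_of_lt (q : R) {n k : ℕ} (h : n < k) : gaussBinom q n k = 0 := by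
  induction n generalizing k with
  | zero => obtain ⟨k, rfl⟩ := Nat.exists_eq_succ_of_ne_zero h.ne'; rfl
  | succ n ih =>
    obtain ⟨k, rfl⟩ := Nat.exists_eq_succ_of_ne_zero (Nat.ne_zero_of_lt h)
    rw [Nat.succ_eq_add_one, gaussBinom_succ_succ, ih (by omega), ih (by omega)]
    simp

@[simp]
lemma gaussBinom_self (q : R) (n : ℕ) : gaussBinom q n n = 1 := by
  induction n with
  | zero => rfl
  | succ n ih => simp [gaussBinom_succ_succ, ih, gaussBinom_eq_zero_of_lt]

/-- The finite product `(q; q)_n = (1 - q) ⋯ (1 - q ^ n)`. -/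
def qPochhammer (q : R) (n : ℕ) : R := ∏ i ∈ Finset.range n, (1 - q ^ (i + 1))

lemma qPochhammer_succ (q : R) (n : ℕ) :
    qPochhammer q (n + 1) = qPochhammer q n * (1 - q ^ (n + 1)) :=
  Finset.prod_range_succ _ _

lemma gaussBinom_add_mul_qPochhammer (q : R) (i j : ℕ) :
    gaussBinom q (i + j) i * (qPochhammer q i * qPochhammer q j) = qPochhammer q (i + j) := by
  induction hn : i + j generalizing i j with
  | zero =>
    obtain ⟨rfl, rfl⟩ : i = 0 ∧ j = 0 := by omega
    simp [qPochhammer]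
  | succ n ih =>
    rcases i with _ | i
    · obtain rfl : j = n + 1 := by omega
      simp [qPochhammer]
    rcases j with _ | j
    · obtain rfl : i = n := by omega
      simp [qPochhammer]
    have h₁ := ih i (j + 1) (by omega)
    have h₂ := ih (i + 1) j (by omega)
    obtain rfl : n = i + j + 1 := by omega
    rw [qPochhammer_succ] at h₁ h₂
    rw [gaussBinom_succ_succ, qPochhammer_succ q i, qPochhammer_succ q j, qPochhammer_succ]
    linear_combination (1 - q ^ (i + 1)) * h₁ + q ^ (i + 1) * (1 - q ^ (j + 1)) * h₂

/-- The `q`-binomial theorem, with `q = p ^ 2`. -/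
lemma prod_one_add_eq_sum_gaussBinom (p y : R) (n : ℕ) :
    ∏ j ∈ Finset.range n, (1 + p ^ (2 * j + 1) * y) =
      ∑ k ∈ Finset.range (n + 1), gaussBinom (p ^ 2) n k * p ^ (k ^ 2) * y ^ k := by
  induction n generalizing y with
  | zero => simp
  | succ n ih =>
    have hprod : ∏ j ∈ Finset.range n, (1 + p ^ (2 * (j + 1) + 1) * y) =
        ∏ j ∈ Finset.range n, (1 + p ^ (2 * j + 1) * (p ^ 2 * y)) :=
      Finset.prod_congr rfl fun j _ ↦ by ring
    have hterm (k : ℕ) : gaussBinom (p ^ 2) (n + 1) (k + 1) * p ^ ((k + 1) ^ 2) * y ^ (k + 1) =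
        p * y * (gaussBinom (p ^ 2) n k * p ^ (k ^ 2) * (p ^ 2 * y) ^ k) +
        gaussBinom (p ^ 2) n (k + 1) * p ^ ((k + 1) ^ 2) * (p ^ 2 * y) ^ (k + 1) := by
      rw [gaussBinom_succ_succ]
      ring
    rw [Finset.prod_range_succ', hprod, ih, Finset.sum_range_succ' _ (n + 1), Finset.sum_congr rfl
      fun k _ ↦ hterm k, Finset.sum_add_distrib, ← Finset.mul_sum,
      Finset.sum_range_succ (fun k ↦ gaussBinom (p ^ 2) n (k + 1) * _ * _),
      gaussBinom_eq_zero_of_lt _ n.lt_succ_self]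
    have h := Finset.sum_range_succ' (fun k ↦ gaussBinom (p ^ 2) n k * p ^ (k ^ 2) *
      (p ^ 2 * y) ^ k) n
    simp only [gaussBinom_zero_right, mul_zero, zero_add, pow_zero, ne_eq, OfNat.ofNat_ne_zero,
      not_false_eq_true, zero_pow, mul_one, pow_one, zero_mul, add_zero] at h ⊢
    linear_combination h

end Algebra

/-- The coefficients of the finite Jacobi triple product. -/
def tripleCoeff {R : Type*} [CommRing R] (q : R) (N : ℕ) (k : ℤ) : R :=
  if -(N : ℤ) ≤ k then gaussBinom q (2 * N) (N + k).toNat else 0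

lemma prod_shifted {K : Type*} [Field K] {p z : K} (hp : p ≠ 0) (hz : z ≠ 0) (N : ℕ) :
    ∏ j ∈ Finset.range N, (1 + p ^ (2 * j + 1) * (p ^ (-(2 * N : ℤ)) * z)) =
      p ^ (-(N : ℤ) ^ 2) * z ^ N * ∏ j ∈ Finset.range N, (1 + p ^ (2 * j + 1) * z⁻¹) := by
  induction N with
  | zero => simp
  | succ N ih =>
    have hprod : ∏ j ∈ Finset.range N,
        (1 + p ^ (2 * (j + 1) + 1) * (p ^ (-(2 * (N + 1 : ℕ) : ℤ)) * z)) =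
        ∏ j ∈ Finset.range N, (1 + p ^ (2 * j + 1) * (p ^ (-(2 * N : ℤ)) * z)) := by
      refine Finset.prod_congr rfl fun j _ ↦ ?_
      simp only [← mul_assoc, ← zpow_natCast, ← zpow_add₀ hp]
      congr 3
      push_cast
      ring
    have h₁ : p ^ (2 * 0 + 1) * p ^ (-(2 * (N + 1 : ℕ) : ℤ)) = (p ^ (2 * N + 1))⁻¹ := by
      simp only [← zpow_natCast, ← zpow_add₀ hp, ← zpow_neg]
      congr 1
    have h₂ : p ^ (-((N + 1 : ℕ) : ℤ) ^ 2) = p ^ (-(N : ℤ) ^ 2) * (p ^ (2 * N + 1))⁻¹ := by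
      simp only [← zpow_natCast, ← zpow_add₀ hp, ← zpow_neg]
      congr 1
      push_cast
      ring
    rw [Finset.prod_range_succ', hprod, ih, Finset.prod_range_succ, ← mul_assoc (p ^ (2 * 0 + 1)),
      h₁, h₂]
    field_simp
    ring

/-- The finite form of the Jacobi triple product identity. -/
lemma hasSum_tripleCoeff {K : Type*} [Field K] [TopologicalSpace K] {p z : K}
    (hp : p ≠ 0) (hz : z ≠ 0) (N : ℕ) :
    HasSum (fun k : ℤ ↦ tripleCoeff (p ^ 2) N k * (p ^ (k ^ 2) * z ^ k))
      (∏ j ∈ Finset.range N, ((1 + p ^ (2 * j + 1) * z) * (1 + p ^ (2 * j + 1) * z⁻¹))) := by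
  have hinj : Function.Injective fun i : ℕ ↦ (i : ℤ) - N := fun a b h ↦ by simpa using h
  rw [← hinj.hasSum_iff]
  · have key := prod_one_add_eq_sum_gaussBinom p (p ^ (-(2 * N : ℤ)) * z) (2 * N)
    have hprod : ∏ j ∈ Finset.range N,
        (1 + p ^ (2 * (N + j) + 1) * (p ^ (-(2 * N : ℤ)) * z)) =
        ∏ j ∈ Finset.range N, (1 + p ^ (2 * j + 1) * z) := by
      refine Finset.prod_congr rfl fun j _ ↦ ?_
      simp only [← mul_assoc, ← zpow_natCast, ← zpow_add₀ hp]
      congr 3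
      push_cast
      ring
    rw [two_mul N, Finset.prod_range_add, hprod, ← two_mul N, prod_shifted hp hz] at key
    have hval : ∏ j ∈ Finset.range N, ((1 + p ^ (2 * j + 1) * z) * (1 + p ^ (2 * j + 1) * z⁻¹)) =
        ∑ k ∈ Finset.range (2 * N + 1), tripleCoeff (p ^ 2) N ((k : ℤ) - N) *
          (p ^ (((k : ℤ) - N) ^ 2) * z ^ ((k : ℤ) - N)) := by
      have hc : p ^ (-(N : ℤ) ^ 2) * z ^ N ≠ 0 := by positivity
      apply mul_left_cancel₀ hc
      rw [Finset.prod_mul_distrib, mul_comm (∏ j ∈ Finset.range N, (1 + p ^ (2 * j + 1) * z)),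
        ← mul_assoc, key, Finset.mul_sum]
      refine Finset.sum_congr rfl fun k _ ↦ ?_
      have hg : tripleCoeff (p ^ 2) N ((k : ℤ) - N) = gaussBinom (p ^ 2) (2 * N) k := by
        simp [tripleCoeff]
      have hz' : z ^ k = z ^ N * z ^ ((k : ℤ) - N) := by
        rw [← zpow_natCast, ← zpow_natCast, ← zpow_add₀ hz]
        congr 1
        ring
      have hp' : p ^ k ^ 2 * (p ^ (-(2 * N : ℤ))) ^ k =
          p ^ (-(N : ℤ) ^ 2) * p ^ (((k : ℤ) - N) ^ 2) := by
        simp only [← zpow_natCast, ← zpow_mul, ← zpow_add₀ hp]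
        congr 1
        push_cast
        ring
      rw [hg, mul_pow, hz']
      linear_combination gaussBinom (p ^ 2) (2 * N) k * z ^ N * z ^ ((k : ℤ) - N) * hp'
    rw [hval]
    refine hasSum_sum_of_ne_finset_zero fun k hk ↦ ?_
    have : 2 * N < k := by simpa using hk
    simp [tripleCoeff, gaussBinom_eq_zero_of_lt _ this]
  · intro k hk
    have : ¬ -(N : ℤ) ≤ k := fun h ↦ hk ⟨(N + k).toNat, by simp; omega⟩
    simp [tripleCoeff, this]

lemma one_sub_ne_zero_of_norm_lt_one {x : ℂ} (hx : ‖x‖ < 1) : 1 - x ≠ 0 := by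
  intro h
  rw [← sub_eq_zero.mp h] at hx
  simp at hx

lemma norm_pow_succ_lt_one {q : ℂ} (hq : ‖q‖ < 1) (n : ℕ) : ‖q ^ (n + 1)‖ < 1 := by
  rw [norm_pow]
  exact pow_lt_one₀ (norm_nonneg q) hq n.succ_ne_zero

lemma qPochhammer_ne_zero {q : ℂ} (hq : ‖q‖ < 1) (n : ℕ) : qPochhammer q n ≠ 0 :=
  Finset.prod_ne_zero_iff.mpr fun i _ ↦
    one_sub_ne_zero_of_norm_lt_one (norm_pow_succ_lt_one hq i)

lemma tendsto_qPochhammer {q : ℂ} (hq : ‖q‖ < 1) :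
    Tendsto (qPochhammer q) atTop (𝓝 (∏' n : ℕ, (1 - q ^ (n + 1)))) :=
  (ModularForm.multipliable_one_sub_pow hq).hasProd.tendsto_prod_nat

/-- A product `∏ (1 - x * q ^ n)` with `‖q‖ < 1` vanishes only if one of its factors does. -/
lemma tprod_one_sub_mul_pow_ne_zero {q : ℂ} (hq : ‖q‖ < 1) {x : ℂ}
    (hx : ∀ n : ℕ, 1 - x * q ^ n ≠ 0) : ∏' n : ℕ, (1 - x * q ^ n) ≠ 0 := by
  simp_rw [sub_eq_add_neg] at hx ⊢
  refine tprod_one_add_ne_zero_of_summable hx ?_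
  simpa using (summable_geometric_of_lt_one (norm_nonneg q) hq).mul_left ‖x‖

lemma multipliable_one_sub_mul_pow {q : ℂ} (hq : ‖q‖ < 1) (x : ℂ) :
    Multipliable fun n : ℕ ↦ 1 - x * q ^ n := by
  simp_rw [sub_eq_add_neg]
  refine multipliable_one_add_of_summable ?_
  simpa using (summable_geometric_of_lt_one (norm_nonneg q) hq).mul_left ‖x‖

lemma tprod_one_sub_pow_ne_zero {q : ℂ} (hq : ‖q‖ < 1) : ∏' n : ℕ, (1 - q ^ (n + 1)) ≠ 0 := by
  simp_rw [pow_succ']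
  refine tprod_one_sub_mul_pow_ne_zero hq fun n ↦ ?_
  rw [← pow_succ']
  exact one_sub_ne_zero_of_norm_lt_one (norm_pow_succ_lt_one hq n)

lemma gaussBinom_eq_div {q : ℂ} (hq : ‖q‖ < 1) (i j : ℕ) :
    gaussBinom q (i + j) i = qPochhammer q (i + j) / (qPochhammer q i * qPochhammer q j) :=
  eq_div_of_mul_eq (mul_ne_zero (qPochhammer_ne_zero hq i) (qPochhammer_ne_zero hq j))
    (gaussBinom_add_mul_qPochhammer q i j)

lemma exists_norm_gaussBinom_le {q : ℂ} (hq : ‖q‖ < 1) :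
    ∃ C : ℝ, ∀ n k, ‖gaussBinom q n k‖ ≤ C := by
  have h := tendsto_qPochhammer hq
  obtain ⟨A, hA⟩ := h.norm.bddAbove_range
  obtain ⟨B, hB⟩ := (h.inv₀ (tprod_one_sub_pow_ne_zero hq)).norm.bddAbove_range
  have hA' (n : ℕ) : ‖qPochhammer q n‖ ≤ A := hA ⟨n, rfl⟩
  have hB' (n : ℕ) : ‖(qPochhammer q n)⁻¹‖ ≤ B := hB ⟨n, rfl⟩
  have hA0 : 0 ≤ A := (norm_nonneg _).trans (hA' 0)
  have hB0 : 0 ≤ B := (norm_nonneg _).trans (hB' 0)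
  refine ⟨A * (B * B), fun n k ↦ ?_⟩
  rcases lt_or_ge n k with hnk | hkn
  · rw [gaussBinom_eq_zero_of_lt q hnk, norm_zero]
    positivity
  · obtain ⟨j, rfl⟩ := Nat.exists_eq_add_of_le hkn
    rw [gaussBinom_eq_div hq, div_eq_mul_inv, mul_inv, norm_mul, norm_mul]
    gcongr
    exacts [hA' _, hB' _, hB' _]

lemma tendsto_tripleCoeff {q : ℂ} (hq : ‖q‖ < 1) (k : ℤ) :
    Tendsto (tripleCoeff q · k) atTop (𝓝 (∏' n : ℕ, (1 - q ^ (n + 1)))⁻¹) := by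
  have h := tendsto_qPochhammer hq
  have hne := tprod_one_sub_pow_ne_zero hq
  have hadd : Tendsto (fun N : ℕ ↦ ((N : ℤ) + k).toNat) atTop atTop :=
    tendsto_atTop.mpr fun b ↦ by
      filter_upwards [eventually_ge_atTop (b + k.natAbs)] with N hN
      omega
  have hsub : Tendsto (fun N : ℕ ↦ ((N : ℤ) - k).toNat) atTop atTop :=
    tendsto_atTop.mpr fun b ↦ by
      filter_upwards [eventually_ge_atTop (b + k.natAbs)] with N hN
      omega
  have hlim := ((h.comp (tendsto_id.const_mul_atTop' (zero_lt_two' ℕ))).div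
    ((h.comp hadd).mul (h.comp hsub)) (mul_ne_zero hne hne))
  rw [div_mul_cancel_left₀ hne] at hlim
  refine hlim.congr' ?_
  filter_upwards [eventually_ge_atTop k.natAbs] with N hN
  have hs : 2 * N = (N + k).toNat + (N - k).toNat := by omega
  have hk : -(N : ℤ) ≤ k := by omega
  simp only [Function.comp_apply, id, tripleCoeff, hk, if_true, Pi.div_apply]
  rw [hs, gaussBinom_eq_div hq]

lemma jacobiTheta₂_term_eq (n : ℤ) (w τ : ℂ) :
    jacobiTheta₂_term n w τ =
      Complex.exp (Real.pi * I * τ) ^ (n ^ 2) * Complex.exp (2 * Real.pi * I * w) ^ n := by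
  rw [jacobiTheta₂_term, ← Complex.exp_int_mul, ← Complex.exp_int_mul, ← Complex.exp_add]
  congr 1
  push_cast
  ring

lemma norm_exp_pi_mul_I_lt_one {τ : ℂ} (hτ : 0 < τ.im) : ‖Complex.exp (Real.pi * I * τ)‖ < 1 := by
  rw [Complex.norm_exp, Real.exp_lt_one_iff]
  simpa using mul_pos Real.pi_pos hτ

/-- The **Jacobi triple product identity**. -/
theorem tendsto_prod_jacobiTheta₂ (w : ℂ) {τ : ℂ} (hτ : 0 < τ.im) :
    Tendsto (fun N ↦ ∏ j ∈ Finset.range N,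
      ((1 + Complex.exp (Real.pi * I * τ) ^ (2 * j + 1) * Complex.exp (2 * Real.pi * I * w)) *
        (1 + Complex.exp (Real.pi * I * τ) ^ (2 * j + 1) * (Complex.exp (2 * Real.pi * I * w))⁻¹))) atTop
      (𝓝 ((∏' n : ℕ, (1 - (Complex.exp (Real.pi * I * τ) ^ 2) ^ (n + 1)))⁻¹ * jacobiTheta₂ w τ)) := by
  have hq : ‖Complex.exp (Real.pi * I * τ) ^ 2‖ < 1 := norm_pow_succ_lt_one (norm_exp_pi_mul_I_lt_one hτ) 1
  obtain ⟨C, hC⟩ := exists_norm_gaussBinom_le hq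
  have hC0 : 0 ≤ C := (norm_nonneg _).trans (hC 0 0)
  simp_rw [← (hasSum_tripleCoeff (exp_ne_zero _) (exp_ne_zero _) _).tsum_eq,
    ← jacobiTheta₂_term_eq]
  rw [jacobiTheta₂, ← tsum_mul_left]
  refine tendsto_tsum_of_dominated_convergence
    (bound := fun k : ℤ ↦ C * ‖jacobiTheta₂_term k w τ‖)
    (((summable_jacobiTheta₂_term_iff w τ).mpr hτ).norm.mul_left C)
    (fun k ↦ (tendsto_tripleCoeff hq k).mul_const _) (.of_forall fun N k ↦ ?_)
  rw [norm_mul]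
  gcongr
  rw [tripleCoeff]
  split_ifs
  · exact hC _ _
  · simpa using hC0

end JacobiTripleProduct

lemma jacobiThetaHalf_eq_jacobiTheta₂ (w τ : ℂ) :
    jacobiThetaHalf w τ = -I * Complex.exp (Real.pi * I * (τ / 4 - w)) *
      jacobiTheta₂ (w + 1 / 2 - τ / 2) τ := by
  have hI : -I = Complex.exp (-(Real.pi / 2 * I)) := by
    rw [exp_neg, exp_pi_div_two_mul_I, inv_I]
  rw [jacobiThetaHalf, jacobiTheta₂, ← tsum_mul_left, ← (Equiv.subRight (1 : ℤ)).tsum_eq]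
  refine tsum_congr fun k ↦ ?_
  rw [jacobiTheta₂_term, hI, ← exp_add, ← exp_add]
  congr 1
  simp only [Equiv.subRight_apply]
  push_cast
  ring

/-- The product expansion of `jacobiThetaHalf`, with `x = e^{2πiw}` and `q = e^{2πiτ}`. -/
lemma jacobiThetaHalf_eq_tprod {w τ : ℂ} (hτ : 0 < τ.im) {x q : ℂ}
    (hx : x = Complex.exp (2 * Real.pi * I * w)) (hq : q = Complex.exp (2 * Real.pi * I * τ)) :
    jacobiThetaHalf w τ = -I * Complex.exp (Real.pi * I * (τ / 4 - w)) *
      ((∏' n : ℕ, (1 - q ^ (n + 1))) *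
        ∏' n : ℕ, ((1 - x * q ^ n) * (1 - x⁻¹ * q ^ (n + 1)))) := by
  set p := Complex.exp (Real.pi * I * τ) with hp
  have hp0 : p ≠ 0 := exp_ne_zero _
  have hx0 : x ≠ 0 := hx ▸ exp_ne_zero _
  have hqp : q = p ^ 2 := by
    rw [hq, hp, ← Complex.exp_nat_mul]
    congr 1
    push_cast
    ring
  have hq1 : ‖q‖ < 1 := hqp ▸ norm_pow_succ_lt_one (norm_exp_pi_mul_I_lt_one hτ) 1
  have hz : Complex.exp (2 * Real.pi * I * (w + 1 / 2 - τ / 2)) = -(x * p⁻¹) := by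
    rw [hx, hp, ← exp_neg, ← exp_add, ← neg_one_mul, ← exp_pi_mul_I, ← exp_add]
    congr 1
    ring
  have h₁ := tendsto_prod_jacobiTheta₂ (w + 1 / 2 - τ / 2) hτ
  have hm := (multipliable_one_sub_mul_pow hq1 x).mul
    (multipliable_one_sub_mul_pow hq1 (x⁻¹ * q))
  have h₂ := hm.hasProd.tendsto_prod_nat
  have hfactor (j : ℕ) : (1 + p ^ (2 * j + 1) * -(x * p⁻¹)) *
      (1 + p ^ (2 * j + 1) * (-(x * p⁻¹))⁻¹) = (1 - x * q ^ j) * (1 - x⁻¹ * q * q ^ j) := by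
    rw [hqp]
    field_simp
    ring
  simp_rw [hz, ← hp, hfactor, ← hqp] at h₁
  have h := tendsto_nhds_unique h₁ h₂
  rw [inv_mul_eq_iff_eq_mul₀ (tprod_one_sub_pow_ne_zero hq1)] at h
  rw [jacobiThetaHalf_eq_jacobiTheta₂, h]
  simp_rw [pow_succ' q, mul_assoc]

lemma dedekindEta_eq_tprod (τ : ℂ) {q : ℂ} (hq : q = Complex.exp (2 * Real.pi * I * τ)) :
    dedekindEta τ = Complex.exp (Real.pi * I * τ / 12) * ∏' n : ℕ, (1 - q ^ (n + 1)) := by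
  rw [dedekindEta]
  congr 1
  refine tprod_congr fun n ↦ ?_
  rw [hq, ← Complex.exp_nat_mul]
  congr 2
  push_cast
  ring

/-- For `2 ≤ m`, `1 ≤ r < m/2`, `τ` in the upper half plane and `q = e^{2πiτ}`:
`Θ(rτ; mτ) ≠ 0` and
`Π_{j≥0} ((1 - q^{mj+r})(1 - q^{mj+m-r}))⁻¹ = -i q^{m/12 - r/2} η(mτ)/Θ(rτ; mτ)`. -/
theorem stmt3 (m r : ℕ) (hm : 2 ≤ m) (hr : 1 ≤ r) (hrm : 2 * r < m)
    (τ : ℂ) (hτ : 0 < τ.im) (q : ℂ) (hq : q = Complex.exp (2 * Real.pi * I * τ)) :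
    jacobiThetaHalf ((r : ℂ) * τ) ((m : ℂ) * τ) ≠ 0 ∧
    (∏' j : ℕ, ((1 - q ^ (m * j + r)) * (1 - q ^ (m * j + (m - r))))⁻¹) =
      -I * Complex.exp (2 * Real.pi * I * τ * ((m : ℂ) / 12 - (r : ℂ) / 2)) *
        dedekindEta ((m : ℂ) * τ) / jacobiThetaHalf ((r : ℂ) * τ) ((m : ℂ) * τ) := by
  have hτ' : 0 < ((m : ℂ) * τ).im := by
    rw [← ofReal_natCast, im_ofReal_mul]
    positivity
  have hq0 : q ≠ 0 := hq ▸ exp_ne_zero _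
  have hq1 : ‖q‖ < 1 := by
    rw [hq, Complex.norm_exp, Real.exp_lt_one_iff]
    simpa using mul_pos Real.two_pi_pos hτ
  have hexp (n : ℕ) : q ^ n = Complex.exp (2 * Real.pi * I * (n * τ)) := by
    rw [hq, ← Complex.exp_nat_mul]
    congr 1
    ring
  have hqm : ‖q ^ m‖ < 1 := by
    rw [norm_pow]
    exact pow_lt_one₀ (norm_nonneg q) hq1 (by omega)
  have hfactor (j : ℕ) : (1 - q ^ r * (q ^ m) ^ j) * (1 - (q ^ r)⁻¹ * (q ^ m) ^ (j + 1)) =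
      (1 - q ^ (m * j + r)) * (1 - q ^ (m * j + (m - r))) := by
    have h : q ^ (m * j + (m - r)) * q ^ r = (q ^ m) ^ (j + 1) := by
      rw [← pow_add, ← pow_mul]
      congr 1
      rw [mul_add]
      omega
    rw [← h, pow_add q (m * j) r, pow_mul]
    field_simp
  have hne₁ (j : ℕ) : 1 - q ^ r * (q ^ m) ^ j ≠ 0 := by
    rw [← pow_mul, ← pow_add]
    apply one_sub_ne_zero_of_norm_lt_one
    rw [norm_pow]
    exact pow_lt_one₀ (norm_nonneg q) hq1 (by omega)
  have hne₂ (j : ℕ) : 1 - q ^ (m - r) * (q ^ m) ^ j ≠ 0 := by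
    rw [← pow_mul, ← pow_add]
    apply one_sub_ne_zero_of_norm_lt_one
    rw [norm_pow]
    exact pow_lt_one₀ (norm_nonneg q) hq1 (by omega)
  have hM₁ := multipliable_one_sub_mul_pow hqm (q ^ r)
  have hM₂ := multipliable_one_sub_mul_pow hqm (q ^ (m - r))
  have hsplit (j : ℕ) : (1 - q ^ (m * j + r)) * (1 - q ^ (m * j + (m - r))) =
      (1 - q ^ r * (q ^ m) ^ j) * (1 - q ^ (m - r) * (q ^ m) ^ j) := by
    ring
  have hmul : Multipliable fun j : ℕ ↦ (1 - q ^ (m * j + r)) * (1 - q ^ (m * j + (m - r))) := by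
    simp_rw [hsplit]
    exact hM₁.mul hM₂
  have hne : ∏' j : ℕ, ((1 - q ^ (m * j + r)) * (1 - q ^ (m * j + (m - r)))) ≠ 0 := by
    simp_rw [hsplit]
    rw [hM₁.tprod_mul hM₂]
    exact mul_ne_zero (tprod_one_sub_mul_pow_ne_zero hqm hne₁)
      (tprod_one_sub_mul_pow_ne_zero hqm hne₂)
  have hη := tprod_one_sub_pow_ne_zero hqm
  have hΘ := jacobiThetaHalf_eq_tprod hτ' (hexp r) (hexp m)
  simp_rw [hfactor] at hΘ
  refine ⟨?_, ?_⟩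
  · rw [hΘ]
    exact mul_ne_zero (mul_ne_zero (neg_ne_zero.mpr I_ne_zero) (exp_ne_zero _))
      (mul_ne_zero hη hne)
  · have hconst : Complex.exp (2 * Real.pi * I * τ * ((m : ℂ) / 12 - (r : ℂ) / 2)) *
        Complex.exp (Real.pi * I * (m * τ) / 12) = Complex.exp (Real.pi * I * (m * τ / 4 - r * τ)) := by
      rw [← exp_add]
      congr 1
      ring
    rw [hmul.tprod_inv₀ hne, hΘ, dedekindEta_eq_tprod _ (hexp m), ← hconst]
    have h₁ := exp_ne_zero (2 * Real.pi * I * τ * ((m : ℂ) / 12 - (r : ℂ) / 2))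
    have h₂ := exp_ne_zero (Real.pi * I * (m * τ) / 12)
    have hI := I_ne_zero
    generalize Complex.exp (2 * Real.pi * I * τ * ((m : ℂ) / 12 - (r : ℂ) / 2)) = a at h₁ ⊢
    generalize Complex.exp (Real.pi * I * (m * τ) / 12) = b at h₂ ⊢
    field_simp
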